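/- arXiv:1803.04045 — 7 statements merged into one kernel-verified Lean document; each statement's English description precedes it below -/
import Mathlib

section
/- The merit function f(x) = sup_{y ∈ Q} { ⟨g(y), x − y⟩ + (μ/2)‖y − x‖² } is finite on Q and strongly convex on Q with parameter μ, i.e. for all x₁, x₂ ∈ Q and t ∈ [0,1], f(t x₁ + (1−t) x₂) ≤ t f(x₁) + (1−t) f(x₂) − (μ/2) t (1−t) ‖x₁ − x₂‖². -/
open RealInnerProductSpace

/-- The function `x ↦ ⟪v, x - y⟫ + μ / 2 * ‖y - x‖ ^ 2` satisfies the strong convexity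
inequality with parameter `μ` with equality. -/
lemma inner_add_half_mul_norm_sq_convex_comb {H : Type*} [NormedAddCommGroup H]
    [InnerProductSpace ℝ H] (v y x₁ x₂ : H) (μ t : ℝ) :
    ⟪v, t • x₁ + (1 - t) • x₂ - y⟫ + μ / 2 * ‖y - (t • x₁ + (1 - t) • x₂)‖ ^ 2 =
      t * (⟪v, x₁ - y⟫ + μ / 2 * ‖y - x₁‖ ^ 2) + (1 - t) * (⟪v, x₂ - y⟫ + μ / 2 * ‖y - x₂‖ ^ 2)
        - μ / 2 * t * (1 - t) * ‖x₁ - x₂‖ ^ 2 := by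
  simp only [← real_inner_self_eq_norm_sq, inner_sub_left, inner_sub_right, inner_add_left,
    inner_add_right, real_inner_smul_left, real_inner_smul_right, real_inner_comm y x₁,
    real_inner_comm y x₂, real_inner_comm x₁ x₂]
  ring

theorem statement2 {H : Type*} [NormedAddCommGroup H] [InnerProductSpace ℝ H]
    [FiniteDimensional ℝ H] (Q : Set H) (hQne : Q.Nonempty) (hQcomp : IsCompact Q)
    (hQconv : Convex ℝ Q) (g : H → H) (hgcont : ContinuousOn g Q) (μ : ℝ) (hμ : 0 < μ)
    (hmono : ∀ x ∈ Q, ∀ y ∈ Q, ⟪g x - g y, x - y⟫ ≥ μ * ‖x - y‖ ^ 2)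
    (f : H → ℝ)
    (hf : ∀ x, f x = sSup ((fun y => ⟪g y, x - y⟫ + μ / 2 * ‖y - x‖ ^ 2) '' Q)) :
    (∀ x ∈ Q, BddAbove ((fun y => ⟪g y, x - y⟫ + μ / 2 * ‖y - x‖ ^ 2) '' Q)) ∧
    (∀ x₁ ∈ Q, ∀ x₂ ∈ Q, ∀ t : ℝ, 0 ≤ t → t ≤ 1 →
      f (t • x₁ + (1 - t) • x₂) ≤
        t * f x₁ + (1 - t) * f x₂ - μ / 2 * t * (1 - t) * ‖x₁ - x₂‖ ^ 2) := by
  have hbdd (x : H) : BddAbove ((fun y => ⟪g y, x - y⟫ + μ / 2 * ‖y - x‖ ^ 2) '' Q) :=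
    hQcomp.bddAbove_image (by fun_prop)
  refine ⟨fun x _ => hbdd x, fun x₁ _ x₂ _ t ht₀ ht₁ => ?_⟩
  have hle (x y : H) (hy : y ∈ Q) : ⟪g y, x - y⟫ + μ / 2 * ‖y - x‖ ^ 2 ≤ f x := by
    rw [hf]
    exact le_csSup (hbdd x) ⟨y, hy, rfl⟩
  rw [hf (t • x₁ + (1 - t) • x₂)]
  refine csSup_le (hQne.image _) ?_
  rintro _ ⟨y, hy, rfl⟩
  dsimp only
  rw [inner_add_half_mul_norm_sq_convex_comb]
  have h₁ := mul_le_mul_of_nonneg_left (hle x₁ y hy) ht₀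
  have h₂ := mul_le_mul_of_nonneg_left (hle x₂ y hy) (sub_nonneg.2 ht₁)
  linarith
end

section
/- Let x* ∈ Q be the solution of the variational inequality ⟨g(x*), x* − y⟩ ≤ 0 for all y ∈ Q. Then for x ∈ Q one has f(x) = 0 if and only if x = x*, where f(x) = sup_{y ∈ Q} { ⟨g(y), x − y⟩ + (μ/2)‖y − x‖² }. -/
open RealInnerProductSpace

theorem statement4 {H : Type*} [NormedAddCommGroup H] [InnerProductSpace ℝ H]
    [FiniteDimensional ℝ H] (Q : Set H) (hQne : Q.Nonempty) (hQcomp : IsCompact Q)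
    (hQconv : Convex ℝ Q) (g : H → H) (hgcont : ContinuousOn g Q) (μ : ℝ) (hμ : 0 < μ)
    (hmono : ∀ x ∈ Q, ∀ y ∈ Q, ⟪g x - g y, x - y⟫ ≥ μ * ‖x - y‖ ^ 2)
    (f : H → ℝ)
    (hf : ∀ x, f x = sSup ((fun y => ⟪g y, x - y⟫ + μ / 2 * ‖y - x‖ ^ 2) '' Q))
    (xs : H) (hxs : xs ∈ Q) (hVI : ∀ y ∈ Q, ⟪g xs, xs - y⟫ ≤ 0) :
    ∀ x ∈ Q, (f x = 0 ↔ x = xs) := by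
  intro x hx
  rw [hf]
  constructor
  · intro h
    have hbdd : BddAbove ((fun y => ⟪g y, x - y⟫ + μ / 2 * ‖y - x‖ ^ 2) '' Q) :=
      hQcomp.bddAbove_image <|
        (hgcont.inner (by fun_prop)).add (by fun_prop)
    have hle : ⟪g xs, x - xs⟫ + μ / 2 * ‖xs - x‖ ^ 2 ≤ 0 :=
      h ▸ le_csSup hbdd ⟨xs, hxs, rfl⟩
    have hVIx := hVI x hx
    rw [← neg_sub x xs, inner_neg_right] at hVIx
    have hsq : ‖xs - x‖ ^ 2 = 0 := by
      nlinarith [sq_nonneg ‖xs - x‖]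
    exact (sub_eq_zero.mp (norm_eq_zero.mp (pow_eq_zero_iff two_ne_zero |>.mp hsq))).symm
  · rintro rfl
    refine IsGreatest.csSup_eq ⟨⟨x, hx, by simp⟩, ?_⟩
    rintro _ ⟨y, hy, rfl⟩
    have hm := hmono x hx y hy
    rw [inner_sub_left] at hm
    simp only [norm_sub_rev y x]
    nlinarith [hVI y hy, mul_nonneg hμ.le (sq_nonneg ‖x - y‖)]
end

section
/- Let x* ∈ Q solve the variational inequality ⟨g(x*), x* − y⟩ ≤ 0 for all y ∈ Q. Then for every x ∈ Q, f(x) ≥ (μ/2)‖x − x*‖², where f(x) = sup_{y ∈ Q} { ⟨g(y), x − y⟩ + (μ/2)‖y − x‖² }. -/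
open RealInnerProductSpace

theorem statement5 {H : Type*} [NormedAddCommGroup H] [InnerProductSpace ℝ H]
    [FiniteDimensional ℝ H] (Q : Set H) (hQne : Q.Nonempty) (hQcomp : IsCompact Q)
    (hQconv : Convex ℝ Q) (g : H → H) (hgcont : ContinuousOn g Q) (μ : ℝ) (hμ : 0 < μ)
    (hmono : ∀ x ∈ Q, ∀ y ∈ Q, ⟪g x - g y, x - y⟫ ≥ μ * ‖x - y‖ ^ 2)
    (f : H → ℝ)
    (hf : ∀ x, f x = sSup ((fun y => ⟪g y, x - y⟫ + μ / 2 * ‖y - x‖ ^ 2) '' Q))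
    (xs : H) (hxs : xs ∈ Q) (hVI : ∀ y ∈ Q, ⟪g xs, xs - y⟫ ≤ 0) :
    ∀ x ∈ Q, μ / 2 * ‖x - xs‖ ^ 2 ≤ f x := by
  intro x hx
  rw [hf x]
  have hbdd : BddAbove ((fun y => ⟪g y, x - y⟫ + μ / 2 * ‖y - x‖ ^ 2) '' Q) := by
    refine hQcomp.bddAbove_image (ContinuousOn.add ?_ ?_)
    · exact hgcont.inner (by fun_prop)
    · fun_prop
  refine le_csSup_of_le hbdd ⟨xs, hxs, rfl⟩ ?_
  have hnonneg : 0 ≤ ⟪g xs, x - xs⟫ := by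
    rw [← neg_sub xs x, inner_neg_right]
    exact neg_nonneg.mpr (hVI x hx)
  rw [norm_sub_rev x xs]
  exact le_add_of_nonneg_left hnonneg
end

section
/- Let y₀, …, y_N ∈ Q and λ₀, …, λ_N > 0; put S_N = Σ_{i=0}^N λᵢ, ỹ_N = (1/S_N) Σ_{i=0}^N λᵢ yᵢ, and Δ_N = sup_{x ∈ Q} Σ_{i=0}^N λᵢ [ ⟨g(yᵢ), yᵢ − x⟩ − (μ/2)‖x − yᵢ‖² ]. Then f(ỹ_N) ≤ Δ_N / S_N, where f(x) = sup_{y ∈ Q} { ⟨g(y), x − y⟩ + (μ/2)‖y − x‖² }. -/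
open RealInnerProductSpace

/-- The linear-quadratic function `x ↦ ⟪a, x - z⟫ + m / 2 * ‖z - x‖ ^ 2` lies above its tangents. -/
lemma linear_add_half_sq_norm_tangent_le {H : Type*} [NormedAddCommGroup H]
    [InnerProductSpace ℝ H] {m : ℝ} (hm : 0 ≤ m) (a z w x : H) :
    ⟪a, w - z⟫ + m / 2 * ‖z - w‖ ^ 2 + ⟪a + m • (w - z), x - w⟫ ≤
      ⟪a, x - z⟫ + m / 2 * ‖z - x‖ ^ 2 := by
  have hlin : ⟪a, x - z⟫ = ⟪a, w - z⟫ + ⟪a, x - w⟫ := by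
    rw [← inner_add_right]; congr 1; abel
  have hsq : ‖z - x‖ ^ 2 = ‖z - w‖ ^ 2 + 2 * ⟪w - z, x - w⟫ + ‖x - w‖ ^ 2 := by
    rw [norm_sub_rev z x, norm_sub_rev z w, ← norm_add_sq_real]; congr 2; abel
  rw [inner_add_left, real_inner_smul_left, hlin, hsq]
  nlinarith [mul_nonneg hm (sq_nonneg ‖x - w‖)]

theorem statement6 {H : Type*} [NormedAddCommGroup H] [InnerProductSpace ℝ H]
    [FiniteDimensional ℝ H] (Q : Set H) (hQne : Q.Nonempty) (hQcomp : IsCompact Q)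
    (hQconv : Convex ℝ Q) (g : H → H) (hgcont : ContinuousOn g Q) (μ : ℝ) (hμ : 0 < μ)
    (hmono : ∀ x ∈ Q, ∀ y ∈ Q, ⟪g x - g y, x - y⟫ ≥ μ * ‖x - y‖ ^ 2)
    (f : H → ℝ)
    (hf : ∀ x, f x = sSup ((fun y => ⟪g y, x - y⟫ + μ / 2 * ‖y - x‖ ^ 2) '' Q))
    (N : ℕ) (y : Fin (N + 1) → H) (hy : ∀ i, y i ∈ Q)
    (lam : Fin (N + 1) → ℝ) (hlam : ∀ i, 0 < lam i)
    (S : ℝ) (hS : S = ∑ i, lam i)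
    (ytil : H) (hytil : ytil = (1 / S) • ∑ i, lam i • y i)
    (Δ : ℝ)
    (hΔ : Δ = sSup ((fun x =>
      ∑ i, lam i * (⟪g (y i), y i - x⟫ - μ / 2 * ‖x - y i‖ ^ 2)) '' Q)) :
    f ytil ≤ Δ / S := by
  have hSpos : 0 < S := hS ▸ Finset.sum_pos (fun i _ => hlam i) Finset.univ_nonempty
  have hbary : ∑ i, lam i • (y i - ytil) = 0 := by
    simp only [smul_sub, Finset.sum_sub_distrib, ← Finset.sum_smul, ← hS]
    rw [hytil, smul_smul, mul_one_div_cancel hSpos.ne', one_smul, sub_self]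
  have hbdd : BddAbove ((fun x =>
      ∑ i, lam i * (⟪g (y i), y i - x⟫ - μ / 2 * ‖x - y i‖ ^ 2)) '' Q) :=
    hQcomp.bddAbove_image (Continuous.continuousOn (by fun_prop))
  rw [hf]
  refine csSup_le (hQne.image _) ?_
  rintro _ ⟨z, hz, rfl⟩
  rw [le_div_iff₀ hSpos, hΔ]
  refine le_trans ?_ (le_csSup hbdd ⟨z, hz, rfl⟩)
  set c := g z + μ • (ytil - z)
  have hcross : ∑ i, lam i * ⟪c, y i - ytil⟫ = 0 := by
    simp only [← real_inner_smul_right, ← inner_sum, hbary, inner_zero_right]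
  calc (⟪g z, ytil - z⟫ + μ / 2 * ‖z - ytil‖ ^ 2) * S
      = ∑ i, lam i * (⟪g z, ytil - z⟫ + μ / 2 * ‖z - ytil‖ ^ 2 + ⟪c, y i - ytil⟫) := by
        simp only [mul_add _ _ ⟪c, _⟫, Finset.sum_add_distrib, hcross, ← Finset.sum_mul, ← hS]
        ring
    _ ≤ ∑ i, lam i * (⟪g (y i), y i - z⟫ - μ / 2 * ‖z - y i‖ ^ 2) := by
        refine Finset.sum_le_sum fun i _ => mul_le_mul_of_nonneg_left ?_ (hlam i).le
        have htangent := linear_add_half_sq_norm_tangent_le hμ.le (g z) z ytil (y i)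
        have hstrong := hmono (y i) (hy i) z hz
        rw [inner_sub_left, norm_sub_rev] at hstrong
        linarith
end

section
/- Let β > 0, μ > 0, x₀ ∈ Q, and let y ∈ Q satisfy the optimality condition ⟨g(x₀) + β(y − x₀), x − y⟩ ≥ 0 for all x ∈ Q (i.e. y maximizes x ↦ ⟨g(x₀), x₀ − x⟩ − (β/2)‖x − x₀‖² over Q). Then for every x ∈ Q: ⟨g(y), y − x⟩ − (μ/2)‖x − y‖² ≤ ‖g(y) − g(x₀)‖² / (2(β + μ)) + (β/2)( ‖x − x₀‖² − ‖y − x₀‖² ). -/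
open RealInnerProductSpace

/-- Young's inequality for the inner product, with weight `c`. -/
lemma neg_real_inner_le_young {H : Type*} [NormedAddCommGroup H] [InnerProductSpace ℝ H]
    (u v : H) {c : ℝ} (hc : 0 < c) :
    -⟪u, v⟫ ≤ ‖u‖ ^ 2 / (2 * c) + c / 2 * ‖v‖ ^ 2 := by
  have hsq : ‖u + c • v‖ ^ 2 = ‖u‖ ^ 2 + 2 * (c * ⟪u, v⟫) + c ^ 2 * ‖v‖ ^ 2 := by
    rw [norm_add_sq_real, real_inner_smul_right, norm_smul, mul_pow, Real.norm_eq_abs, sq_abs]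
  have hdiff : ‖u‖ ^ 2 / (2 * c) + c / 2 * ‖v‖ ^ 2 + ⟪u, v⟫ = ‖u + c • v‖ ^ 2 / (2 * c) := by
    rw [hsq]
    field_simp
    ring
  have hnonneg : 0 ≤ ‖u + c • v‖ ^ 2 / (2 * c) := by positivity
  linarith

theorem statement7 {H : Type*} [NormedAddCommGroup H] [InnerProductSpace ℝ H]
    [FiniteDimensional ℝ H] (Q : Set H) (hQne : Q.Nonempty) (hQc : IsClosed Q)
    (hQconv : Convex ℝ Q) (g : H → H) (β μ : ℝ) (hβ : 0 < β) (hμ : 0 < μ)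
    (x₀ : H) (hx₀ : x₀ ∈ Q) (y : H) (hy : y ∈ Q)
    (hopt : ∀ x ∈ Q, ⟪g x₀ + β • (y - x₀), x - y⟫ ≥ 0) :
    ∀ x ∈ Q,
      ⟪g y, y - x⟫ - μ / 2 * ‖x - y‖ ^ 2 ≤
        ‖g y - g x₀‖ ^ 2 / (2 * (β + μ)) + β / 2 * (‖x - x₀‖ ^ 2 - ‖y - x₀‖ ^ 2) := by
  intro x hx
  have hyoung := neg_real_inner_le_young (g y - g x₀) (x - y) (add_pos hβ hμ)
  have hvar := hopt x hx
  rw [inner_add_left, real_inner_smul_left] at hvar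
  rw [inner_sub_left] at hyoung
  have hexpand : ‖x - x₀‖ ^ 2 = ‖y - x₀‖ ^ 2 + 2 * ⟪y - x₀, x - y⟫ + ‖x - y‖ ^ 2 := by
    rw [← norm_add_sq_real, add_comm (y - x₀), sub_add_sub_cancel]
  rw [hexpand, ← neg_sub x y, inner_neg_right]
  linarith
end

section
/- Let β₀ > 0 and L > 0, let N be a natural number, let i₁, …, i_N be positive integers and β₁, …, β_N positive reals satisfying β_{k+1} = 2^{i_{k+1} − 2} β_k for k = 0, …, N−1 and β_N < 2L. Then the total number of inner steps satisfies Σ_{k=0}^{N−1} i_{k+1} = 2N + log₂(β_N/β₀) < 2N + log₂(2L) − log₂(β₀). -/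
theorem statement13 (β₀ L : ℝ) (hβ₀ : 0 < β₀) (hL : 0 < L) (N : ℕ)
    (i : ℕ → ℕ) (hi : ∀ k, 1 ≤ i (k + 1))
    (β : ℕ → ℝ) (hβpos : ∀ k, 0 < β k) (hβ0 : β 0 = β₀)
    (hrec : ∀ k < N, β (k + 1) = (2 : ℝ) ^ ((i (k + 1) : ℝ) - 2) * β k)
    (hβN : β N < 2 * L) :
    (∑ k ∈ Finset.range N, (i (k + 1) : ℝ)) = 2 * N + Real.logb 2 (β N / β₀) ∧
    (∑ k ∈ Finset.range N, (i (k + 1) : ℝ)) < 2 * N + Real.logb 2 (2 * L) - Real.logb 2 β₀ := by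
  have hstep : ∀ k ∈ Finset.range N,
      (i (k + 1) : ℝ) = 2 + (Real.logb 2 (β (k + 1)) - Real.logb 2 (β k)) := by
    intro k hk
    rw [hrec k (Finset.mem_range.mp hk),
      Real.logb_mul (Real.rpow_pos_of_pos two_pos _).ne' (hβpos k).ne',
      Real.logb_rpow two_pos (by norm_num)]
    ring
  have hsum : (∑ k ∈ Finset.range N, (i (k + 1) : ℝ)) = 2 * N + Real.logb 2 (β N / β₀) := by
    rw [Finset.sum_congr rfl hstep, Finset.sum_add_distrib,
      Finset.sum_range_sub (fun k => Real.logb 2 (β k)), hβ0,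
      Real.logb_div (hβpos N).ne' hβ₀.ne', Finset.sum_const, Finset.card_range, nsmul_eq_mul,
      mul_comm]
  refine ⟨hsum, ?_⟩
  rw [hsum, Real.logb_div (hβpos N).ne' hβ₀.ne']
  linarith [Real.logb_lt_logb one_lt_two (hβpos N) hβN]
end

section
/- Let g be Lipschitz with constant L and μ-strongly monotone with μ > 0 on a nonempty closed convex set Q, and let x* ∈ Q solve ⟨g(x*), x* − y⟩ ≤ 0 for all y ∈ Q. For the projection method with step λ = μ/L², i.e. x_{k+1} = π_Q(x_k − (μ/L²) g(x_k)) where π_Q is the metric projection onto Q, one has the one-step contraction ‖x_{k+1} − x*‖² ≤ (1 − μ²/L²) ‖x_k − x*‖², and hence for every k, ‖x_k − x*‖² ≤ ‖x₀ − x*‖² · exp( −k μ²/L² ). -/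
open RealInnerProductSpace

/-- A nearest point of a convex set satisfies the variational inequality of the projection. -/
theorem real_inner_sub_le_zero_of_forall_norm_le {H : Type*} [NormedAddCommGroup H]
    [InnerProductSpace ℝ H] {Q : Set H} (hQ : Convex ℝ Q) {z p : H} (hp : p ∈ Q)
    (hmin : ∀ w ∈ Q, ‖z - p‖ ≤ ‖z - w‖) {w : H} (hw : w ∈ Q) : ⟪z - p, w - p⟫ ≤ 0 := by
  have : Nonempty Q := ⟨⟨p, hp⟩⟩
  refine (norm_eq_iInf_iff_real_inner_le_zero hQ hp).1 (le_antisymm ?_ ?_) w hw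
  · exact le_ciInf fun w => hmin w w.2
  · exact ciInf_le ⟨0, by rintro _ ⟨w, rfl⟩; exact norm_nonneg _⟩ (⟨p, hp⟩ : Q)

/-- A projected step of size `t` moves at most as far from a solution of the variational
inequality as the corresponding step along the difference of the operator values. -/
theorem norm_sub_sq_le_of_projected_step {H : Type*} [NormedAddCommGroup H]
    [InnerProductSpace ℝ H] {a b s v p : H} {t : ℝ} (ht : 0 ≤ t)
    (hproj : ⟪a - t • v - p, s - p⟫ ≤ 0) (hVI : ⟪b, s - p⟫ ≤ 0) :
    ‖p - s‖ ^ 2 ≤ ‖(a - s) - t • (v - b)‖ ^ 2 := by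
  have hdecomp : a - t • v - p = ((a - s) - t • (v - b)) - (p - s) - t • b := by
    rw [smul_sub]; abel
  have hneg : s - p = -(p - s) := by abel
  rw [hdecomp, hneg, inner_neg_right, inner_sub_left, inner_sub_left, real_inner_smul_left,
    real_inner_self_eq_norm_sq] at hproj
  rw [hneg, inner_neg_right] at hVI
  have hexp := norm_sub_sq_real ((a - s) - t • (v - b)) (p - s)
  have hsq := sq_nonneg ‖(a - s) - t • (v - b) - (p - s)‖
  have htb : 0 ≤ t * ⟪b, p - s⟫ := mul_nonneg ht (by linarith)
  linarith

/-- A forward step of size `μ / L ^ 2` contracts for Lipschitz strongly monotone increments. -/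
theorem norm_sub_smul_sq_le {H : Type*} [NormedAddCommGroup H] [InnerProductSpace ℝ H]
    {d v : H} {μ L : ℝ} (hμ : 0 ≤ μ) (hL : 0 < L) (hlip : ‖v‖ ≤ L * ‖d‖)
    (hmono : μ * ‖d‖ ^ 2 ≤ ⟪v, d⟫) :
    ‖d - (μ / L ^ 2) • v‖ ^ 2 ≤ (1 - μ ^ 2 / L ^ 2) * ‖d‖ ^ 2 := by
  have hsq : ‖v‖ ^ 2 ≤ L ^ 2 * ‖d‖ ^ 2 := by
    rw [← mul_pow]; exact pow_le_pow_left₀ (norm_nonneg _) hlip 2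
  have ht : 0 ≤ μ / L ^ 2 := by positivity
  rw [norm_sub_sq_real, real_inner_smul_right, real_inner_comm, norm_smul, mul_pow,
    Real.norm_eq_abs, sq_abs]
  have hv := mul_le_mul_of_nonneg_left hsq (sq_nonneg (μ / L ^ 2))
  have hd := mul_le_mul_of_nonneg_left hmono ht
  have hv_eq : (μ / L ^ 2) ^ 2 * (L ^ 2 * ‖d‖ ^ 2) = μ ^ 2 / L ^ 2 * ‖d‖ ^ 2 := by
    field_simp
  have hd_eq : μ / L ^ 2 * (μ * ‖d‖ ^ 2) = μ ^ 2 / L ^ 2 * ‖d‖ ^ 2 := by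
    field_simp
  linarith

/-- A sequence contracting by `1 - c` at each step decays like `exp (-k c)`. -/
theorem le_mul_exp_of_le_one_sub_mul {u : ℕ → ℝ} {c : ℝ} (hu : ∀ k, 0 ≤ u k)
    (h : ∀ k, u (k + 1) ≤ (1 - c) * u k) (k : ℕ) : u k ≤ u 0 * Real.exp (-(k : ℝ) * c) := by
  induction k with
  | zero => simp
  | succ k ih =>
    calc u (k + 1) ≤ (1 - c) * u k := h k
      _ ≤ Real.exp (-c) * u k :=
        mul_le_mul_of_nonneg_right (Real.one_sub_le_exp_neg c) (hu k)
      _ ≤ Real.exp (-c) * (u 0 * Real.exp (-(k : ℝ) * c)) :=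
        mul_le_mul_of_nonneg_left ih (Real.exp_nonneg _)
      _ = u 0 * Real.exp (-((k + 1 : ℕ) : ℝ) * c) := by
        rw [mul_left_comm, ← Real.exp_add]
        congr 2
        push_cast
        ring

theorem statement14 {H : Type*} [NormedAddCommGroup H] [InnerProductSpace ℝ H]
    [FiniteDimensional ℝ H] (Q : Set H) (hQne : Q.Nonempty) (hQc : IsClosed Q)
    (hQconv : Convex ℝ Q) (g : H → H) (μ L : ℝ) (hμ : 0 < μ) (hμL : μ ≤ L)
    (hlip : ∀ x ∈ Q, ∀ y ∈ Q, ‖g x - g y‖ ≤ L * ‖x - y‖)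
    (hmono : ∀ x ∈ Q, ∀ y ∈ Q, ⟪g x - g y, x - y⟫ ≥ μ * ‖x - y‖ ^ 2)
    (xs : H) (hxs : xs ∈ Q) (hVI : ∀ y ∈ Q, ⟪g xs, xs - y⟫ ≤ 0)
    (π : H → H)
    (hπ : ∀ z, π z ∈ Q ∧ ∀ w ∈ Q, ‖z - π z‖ ≤ ‖z - w‖)
    (x : ℕ → H) (hx0 : x 0 ∈ Q)
    (hxrec : ∀ k, x (k + 1) = π (x k - (μ / L ^ 2) • g (x k))) :
    (∀ k, ‖x (k + 1) - xs‖ ^ 2 ≤ (1 - μ ^ 2 / L ^ 2) * ‖x k - xs‖ ^ 2) ∧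
    (∀ k, ‖x k - xs‖ ^ 2 ≤ ‖x 0 - xs‖ ^ 2 * Real.exp (-(k : ℝ) * μ ^ 2 / L ^ 2)) := by
  have hL : 0 < L := hμ.trans_le hμL
  have hxQ : ∀ k, x k ∈ Q := by
    rintro (_ | k)
    · exact hx0
    · exact hxrec k ▸ (hπ _).1
  have hstep : ∀ k, ‖x (k + 1) - xs‖ ^ 2 ≤ (1 - μ ^ 2 / L ^ 2) * ‖x k - xs‖ ^ 2 := by
    intro k
    have hproj := real_inner_sub_le_zero_of_forall_norm_le hQconv
      (hπ (x k - (μ / L ^ 2) • g (x k))).1 (hπ _).2 hxs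
    rw [← hxrec] at hproj
    exact (norm_sub_sq_le_of_projected_step (by positivity) hproj (hVI _ (hxQ (k + 1)))).trans
      (norm_sub_smul_sq_le hμ.le hL (hlip _ (hxQ k) _ hxs) (hmono _ (hxQ k) _ hxs))
  refine ⟨hstep, fun k => ?_⟩
  rw [mul_div_assoc]
  exact le_mul_exp_of_le_one_sub_mul (u := fun k => ‖x k - xs‖ ^ 2)
    (fun _ => sq_nonneg _) hstep k
end
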